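/- The loop γ : [0,1] → SO(4) defined by letting γ(t) be the block-diagonal 4×4 matrix whose first block is the 2×2 identity and whose second block is the rotation matrix with entries (cos 2πt, −sin 2πt; sin 2πt, cos 2πt) is a loop based at the identity matrix that is not path-homotopic (relative to its endpoints) to the constant loop at the identity. -/

import Mathlib

open Real

/-- `SO(4)`, the special orthogonal group of `4 × 4` real matrices `A` with `AᵀA = I` and
`det A = 1`, topologized as a subspace of the space of `4 × 4` real matrices. -/
abbrev SO4 := Matrix.specialOrthogonalGroup (Fin 4) ℝ

/-- The block-diagonal matrix with first block the `2 × 2` identity and second block the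
rotation by angle `2πt`. -/
noncomputable def rotLoopMatrix (t : ℝ) : Matrix (Fin 4) (Fin 4) ℝ :=
  !![1, 0, 0, 0;
     0, 1, 0, 0;
     0, 0, cos (2 * π * t), -sin (2 * π * t);
     0, 0, sin (2 * π * t), cos (2 * π * t)]

open Quaternion

namespace QuaternionRotation

/-- The matrix, in the basis `1, i, j, k`, of left multiplication by a quaternion. -/
def leftMatrix : ℍ[ℝ] →* Matrix (Fin 4) (Fin 4) ℝ where
  toFun p :=
    !![p.re, -p.imI, -p.imJ, -p.imK;
       p.imI, p.re, -p.imK, p.imJ;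
       p.imJ, p.imK, p.re, -p.imI;
       p.imK, -p.imJ, p.imI, p.re]
  map_one' := by
    ext i j; fin_cases i <;> fin_cases j <;> simp
  map_mul' p q := by
    ext i j; fin_cases i <;> fin_cases j <;> simp [Matrix.mul_apply, Fin.sum_univ_four] <;> ring

/-- The matrix, in the basis `1, i, j, k`, of right multiplication by the conjugate of a
quaternion. -/
def rightMatrix : ℍ[ℝ] →* Matrix (Fin 4) (Fin 4) ℝ where
  toFun q :=
    !![q.re, q.imI, q.imJ, q.imK;
       -q.imI, q.re, -q.imK, q.imJ;
       -q.imJ, q.imK, q.re, -q.imI;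
       -q.imK, -q.imJ, q.imI, q.re]
  map_one' := by
    ext i j; fin_cases i <;> fin_cases j <;> simp
  map_mul' p q := by
    ext i j; fin_cases i <;> fin_cases j <;> simp [Matrix.mul_apply, Fin.sum_univ_four] <;> ring

lemma commute_leftMatrix_rightMatrix (p q : ℍ[ℝ]) :
    Commute (leftMatrix p) (rightMatrix q) := by
  ext i j
  fin_cases i <;> fin_cases j <;>
    simp [leftMatrix, rightMatrix, Matrix.mul_apply, Fin.sum_univ_four] <;> ring

lemma leftMatrix_star (p : ℍ[ℝ]) : leftMatrix (star p) = (leftMatrix p).transpose := by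
  ext i j
  fin_cases i <;> fin_cases j <;> simp [leftMatrix]

lemma rightMatrix_star (q : ℍ[ℝ]) : rightMatrix (star q) = (rightMatrix q).transpose := by
  ext i j
  fin_cases i <;> fin_cases j <;> simp [rightMatrix]

lemma det_leftMatrix (p : ℍ[ℝ]) : (leftMatrix p).det = normSq p ^ 2 := by
  rw [normSq_def']
  simp [leftMatrix, Matrix.det_succ_row_zero, Fin.sum_univ_succ, Fin.succAbove]
  ring

lemma det_rightMatrix (q : ℍ[ℝ]) : (rightMatrix q).det = normSq q ^ 2 := by
  rw [normSq_def']
  simp [rightMatrix, Matrix.det_succ_row_zero, Fin.sum_univ_succ, Fin.succAbove]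
  ring

lemma normSq_eq_one_of_mem_unitary {p : ℍ[ℝ]} (hp : p ∈ unitary ℍ[ℝ]) : normSq p = 1 := by
  have h := Unitary.star_mul_self_of_mem hp
  rw [Quaternion.star_mul_self] at h
  exact Quaternion.coe_injective h

lemma mem_unitary_of_normSq_eq_one {p : ℍ[ℝ]} (hp : normSq p = 1) : p ∈ unitary ℍ[ℝ] := by
  rw [Unitary.mem_iff, Quaternion.star_mul_self, Quaternion.self_mul_star, hp]
  simp

lemma leftMatrix_mul_rightMatrix_mem {p q : ℍ[ℝ]} (hp : p ∈ unitary ℍ[ℝ])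
    (hq : q ∈ unitary ℍ[ℝ]) : leftMatrix p * rightMatrix q ∈ SO4 := by
  refine Matrix.mem_specialOrthogonalGroup_iff.2 ⟨mul_mem ?_ ?_, ?_⟩
  · rw [Matrix.mem_orthogonalGroup_iff, ← leftMatrix_star, ← map_mul,
      Unitary.mul_star_self_of_mem hp, map_one]
  · rw [Matrix.mem_orthogonalGroup_iff, ← rightMatrix_star, ← map_mul,
      Unitary.mul_star_self_of_mem hq, map_one]
  · simp [det_leftMatrix, det_rightMatrix, normSq_eq_one_of_mem_unitary hp,
      normSq_eq_one_of_mem_unitary hq]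

/-- The spin cover of `SO(4)`, sending `(p, q)` to the rotation `x ↦ p * x * star q` of the
quaternions. -/
noncomputable def spinHom : unitary ℍ[ℝ] × unitary ℍ[ℝ] →* SO4 where
  toFun g := ⟨leftMatrix g.1 * rightMatrix g.2, leftMatrix_mul_rightMatrix_mem g.1.2 g.2.2⟩
  map_one' := by ext1; simp
  map_mul' g h := by
    ext1
    simp only [Prod.fst_mul, Prod.snd_mul, Submonoid.coe_mul, map_mul]
    exact (commute_leftMatrix_rightMatrix _ _).mul_mul_mul_comm _ _

lemma coe_spinHom (g : unitary ℍ[ℝ] × unitary ℍ[ℝ]) :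
    (spinHom g : Matrix (Fin 4) (Fin 4) ℝ) = leftMatrix g.1 * rightMatrix g.2 := rfl

lemma continuous_leftMatrix : Continuous leftMatrix := by
  refine continuous_matrix fun i j ↦ ?_
  fin_cases i <;> fin_cases j <;> simp only [leftMatrix, MonoidHom.coe_mk, OneHom.coe_mk] <;>
    first
    | exact continuous_re
    | exact continuous_imI
    | exact continuous_imJ
    | exact continuous_imK
    | exact continuous_imI.neg
    | exact continuous_imJ.neg
    | exact continuous_imK.neg

lemma continuous_rightMatrix : Continuous rightMatrix := by
  refine continuous_matrix fun i j ↦ ?_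
  fin_cases i <;> fin_cases j <;> simp only [rightMatrix, MonoidHom.coe_mk, OneHom.coe_mk] <;>
    first
    | exact continuous_re
    | exact continuous_imI
    | exact continuous_imJ
    | exact continuous_imK
    | exact continuous_imI.neg
    | exact continuous_imJ.neg
    | exact continuous_imK.neg

lemma continuous_spinHom : Continuous spinHom :=
  ((continuous_leftMatrix.comp (continuous_subtype_val.comp continuous_fst)).mul
    (continuous_rightMatrix.comp (continuous_subtype_val.comp continuous_snd))).subtype_mk _

/-- The quaternion whose coordinates are the entries of a column of a matrix. -/
def column (A : Matrix (Fin 4) (Fin 4) ℝ) (j : Fin 4) : ℍ[ℝ] := ⟨A 0 j, A 1 j, A 2 j, A 3 j⟩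

@[simp]
lemma re_column (A : Matrix (Fin 4) (Fin 4) ℝ) (j : Fin 4) : (column A j).re = A 0 j := rfl

@[simp]
lemma imI_column (A : Matrix (Fin 4) (Fin 4) ℝ) (j : Fin 4) : (column A j).imI = A 1 j := rfl

@[simp]
lemma imJ_column (A : Matrix (Fin 4) (Fin 4) ℝ) (j : Fin 4) : (column A j).imJ = A 2 j := rfl

@[simp]
lemma imK_column (A : Matrix (Fin 4) (Fin 4) ℝ) (j : Fin 4) : (column A j).imK = A 3 j := rfl

lemma column_injective : Function.Injective column := by
  intro A B h
  ext i j
  obtain ⟨h0, h1, h2, h3⟩ := QuaternionAlgebra.ext_iff.1 (congrFun h j)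
  fin_cases i
  exacts [h0, h1, h2, h3]

lemma column_one_zero : column 1 0 = 1 := by
  ext <;> simp

lemma column_leftMatrix_mul_rightMatrix (p q : ℍ[ℝ]) (j : Fin 4) :
    column (leftMatrix p * rightMatrix q) j = p * column 1 j * star q := by
  fin_cases j <;>
    simp only [Fin.mk_one, Fin.zero_eta, Fin.reduceFinMk] <;>
    ext <;> simp [leftMatrix, rightMatrix] <;> ring

/-- Averaging over `1, i, j, k` produces an intertwiner between two quaternionic triples. -/
lemma exists_ne_zero_mul_eq {u v w : ℍ[ℝ]} (hu : u * u = -1) (hv : v * v = -1)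
    (huv : u * v = w) (hvu : v * u = -w) :
    ∃ q ≠ 0, u * q = q * column 1 1 ∧ v * q = q * column 1 2 ∧ w * q = q * column 1 3 := by
  set i : ℍ[ℝ] := column 1 1 with hi
  set j : ℍ[ℝ] := column 1 2 with hj
  set k : ℍ[ℝ] := column 1 3 with hk
  have hii : i * i = -1 := by ext <;> simp [hi]
  have hjj : j * j = -1 := by ext <;> simp [hj]
  have hij : i * j = k := by ext <;> simp [hi, hj, hk]
  have hji : j * i = -k := by ext <;> simp [hi, hj, hk]
  have hki : k * i = j := by ext <;> simp [hi, hj, hk]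
  have hkj : k * j = -i := by ext <;> simp [hi, hj, hk]
  have huw : u * w = -v := by rw [← huv, ← mul_assoc, hu, neg_one_mul]
  have hvw : v * w = u := by
    rw [← huv, ← mul_assoc, hvu, ← huv, neg_mul, mul_assoc, hv, mul_neg_one, neg_neg]
  let T : ℍ[ℝ] → ℍ[ℝ] := fun y ↦ y - u * y * i - v * y * j - w * y * k
  have hTu (y : ℍ[ℝ]) : u * T y = T y * i := by
    have h₁ : u * T y = u * y - (u * u) * y * i - (u * v) * y * j - (u * w) * y * k := by
      simp only [T]; noncomm_ring
    have h₂ : T y * i = y * i - u * y * (i * i) - v * y * (j * i) - w * y * (k * i) := by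
      simp only [T]; noncomm_ring
    rw [h₁, h₂, hu, huv, huw, hii, hji, hki]
    noncomm_ring
  have hTv (y : ℍ[ℝ]) : v * T y = T y * j := by
    have h₁ : v * T y = v * y - (v * u) * y * i - (v * v) * y * j - (v * w) * y * k := by
      simp only [T]; noncomm_ring
    have h₂ : T y * j = y * j - u * y * (i * j) - v * y * (j * j) - w * y * (k * j) := by
      simp only [T]; noncomm_ring
    rw [h₁, h₂, hv, hvu, hvw, hij, hjj, hkj]
    noncomm_ring
  have hT : ∃ y, T y ≠ 0 := by
    by_contra! h
    have h4 : T 1 - T i * i - T j * j - T k * k = ((4 : ℝ) : ℍ[ℝ]) := by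
      ext <;> simp [T, hi, hj, hk] <;> ring
    simp only [h, zero_mul, sub_zero] at h4
    exact four_ne_zero (coe_injective h4.symm)
  obtain ⟨y, hy⟩ := hT
  refine ⟨T y, hy, hTu y, hTv y, ?_⟩
  rw [← huv, mul_assoc, hTv, ← mul_assoc, hTu, mul_assoc, hij]

lemma exists_mem_unitary_eq_mul_star {u v w : ℍ[ℝ]} (hu : u * u = -1) (hv : v * v = -1)
    (huv : u * v = w) (hvu : v * u = -w) :
    ∃ q ∈ unitary ℍ[ℝ], u = q * column 1 1 * star q ∧ v = q * column 1 2 * star q ∧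
      w = q * column 1 3 * star q := by
  obtain ⟨q, hq, hqu, hqv, hqw⟩ := exists_ne_zero_mul_eq hu hv huv hvu
  have hr : (‖q‖⁻¹ • q) ∈ unitary ℍ[ℝ] := by
    apply mem_unitary_of_normSq_eq_one
    rw [normSq_eq_norm_mul_self, norm_smul, norm_inv, norm_norm,
      inv_mul_cancel₀ (norm_ne_zero_iff.2 hq), one_mul]
  have hconj {a b : ℍ[ℝ]} (h : a * q = q * b) :
      a = (‖q‖⁻¹ • q) * b * star (‖q‖⁻¹ • q) := by
    rw [smul_mul_assoc, ← h, ← mul_smul_comm, mul_assoc, Unitary.mul_star_self_of_mem hr, mul_one]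
  exact ⟨_, hr, hconj hqu, hconj hqv, hconj hqw⟩

lemma sum_mul_eq_one_apply (A : SO4) (a b : Fin 4) :
    A.1 0 a * A.1 0 b + A.1 1 a * A.1 1 b + A.1 2 a * A.1 2 b + A.1 3 a * A.1 3 b =
      (1 : Matrix (Fin 4) (Fin 4) ℝ) a b := by
  have h := (Matrix.mem_orthogonalGroup_iff' (Fin 4) ℝ).1
    (Matrix.mem_specialOrthogonalGroup_iff.1 A.2).1
  rw [← h]
  simp [Matrix.mul_apply, Fin.sum_univ_four]

lemma normSq_column (A : SO4) (j : Fin 4) : normSq (column A.1 j) = 1 := by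
  rw [normSq_def']
  have h := sum_mul_eq_one_apply A j j
  simp only [Matrix.one_apply_eq] at h
  simp only [re_column, imI_column, imJ_column, imK_column]
  linear_combination h

lemma star_star_column_mul_column (A : SO4) {j : Fin 4} (hj : 0 ≠ j) :
    star (star (column A.1 0) * column A.1 j) = -(star (column A.1 0) * column A.1 j) := by
  have h := sum_mul_eq_one_apply A 0 j
  rw [Matrix.one_apply_ne hj] at h
  ext <;> simp
  · linear_combination 2 * h
  all_goals ring

lemma column_mul_star_mul_column (A : SO4) :
    column A.1 1 * star (column A.1 0) * column A.1 2 = column A.1 3 := by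
  have hdet := (Matrix.mem_specialOrthogonalGroup_iff.1 A.2).2
  have h01 := sum_mul_eq_one_apply A 0 1
  have h02 := sum_mul_eq_one_apply A 0 2
  have h12 := sum_mul_eq_one_apply A 1 2
  rw [Matrix.one_apply_ne (by decide)] at h01 h02 h12
  set x := column A.1 1 * star (column A.1 0) * column A.1 2 with hx
  have hre : x.re * A.1 0 3 + x.imI * A.1 1 3 + x.imJ * A.1 2 3 + x.imK * A.1 3 3 = 1 := by
    refine Eq.trans ?_ hdet
    simp [hx, Matrix.det_succ_row_zero, Fin.sum_univ_succ, Fin.succAbove]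
    linear_combination
      h01 * (A.1 0 2 * A.1 0 3 + A.1 1 2 * A.1 1 3 + A.1 2 2 * A.1 2 3 + A.1 3 2 * A.1 3 3) -
      h12 * (A.1 0 0 * A.1 0 3 + A.1 1 0 * A.1 1 3 + A.1 2 0 * A.1 2 3 + A.1 3 0 * A.1 3 3) +
      h02 * (A.1 0 1 * A.1 0 3 + A.1 1 1 * A.1 1 3 + A.1 2 1 * A.1 2 3 + A.1 3 1 * A.1 3 3)
  have hxn : normSq x = 1 := by simp [hx, normSq_column]
  have hcn := normSq_column A 3
  have hsub : normSq (x - column A.1 3) = 0 := by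
    rw [normSq_def'] at hxn hcn ⊢
    simp only [re_column, imI_column, imJ_column, imK_column, re_sub, imI_sub,
      imJ_sub, imK_sub] at hcn ⊢
    linear_combination hxn + hcn - 2 * hre
  exact sub_eq_zero.1 (normSq_eq_zero.1 hsub)

lemma spinHom_surjective : Function.Surjective spinHom := by
  intro A
  set p := column A.1 0 with hp
  have hpu : p ∈ unitary ℍ[ℝ] := mem_unitary_of_normSq_eq_one (normSq_column A 0)
  have hsq {j : Fin 4} (hj : 0 ≠ j) :
      (star p * column A.1 j) * (star p * column A.1 j) = -1 := by
    have h := Quaternion.star_mul_self (star p * column A.1 j)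
    rw [star_star_column_mul_column A hj, map_mul, normSq_star, normSq_column, normSq_column,
      neg_mul, mul_one, coe_one] at h
    rw [← h, neg_neg]
  have huv : (star p * column A.1 1) * (star p * column A.1 2) = star p * column A.1 3 := by
    rw [← column_mul_star_mul_column A]
    simp only [mul_assoc, hp]
  have hvu : (star p * column A.1 2) * (star p * column A.1 1) = -(star p * column A.1 3) := by
    rw [← star_star_column_mul_column A (by decide), ← hp, ← huv, star_mul,
      star_star_column_mul_column A (by decide), star_star_column_mul_column A (by decide),
      neg_mul_neg]
  obtain ⟨q, hq, h1, h2, h3⟩ :=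
    exists_mem_unitary_eq_mul_star (hsq (by decide)) (hsq (by decide)) huv hvu
  refine ⟨(⟨p, hpu⟩ * ⟨q, hq⟩, ⟨q, hq⟩), Subtype.ext (column_injective (funext fun j ↦ ?_))⟩
  rw [coe_spinHom, column_leftMatrix_mul_rightMatrix]
  have hcancel {x : ℍ[ℝ]} {e : ℍ[ℝ]} (h : star p * x = q * e * star q) :
      p * q * e * star q = x := by
    rw [mul_assoc p, mul_assoc p, ← h, ← mul_assoc, Unitary.mul_star_self_of_mem hpu, one_mul]
  fin_cases j
  · refine hcancel ?_
    simp only [Fin.zero_eta, column_one_zero, mul_one, ← hp]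
    rw [Unitary.star_mul_self_of_mem hpu, Unitary.mul_star_self_of_mem hq]
  · exact hcancel h1
  · exact hcancel h2
  · exact hcancel h3

lemma finite_ker_spinHom : (spinHom.ker : Set (unitary ℍ[ℝ] × unitary ℍ[ℝ])).Finite := by
  refine Set.Finite.subset (Set.toFinite {1, -1}) ?_
  rintro ⟨⟨p, hp⟩, ⟨q, hq⟩⟩ h
  have hcol (j : Fin 4) : p * column 1 j * star q = column 1 j := by
    rw [← column_leftMatrix_mul_rightMatrix]
    exact congrArg (fun A : SO4 ↦ column A.1 j) h
  have hcomm (j : Fin 4) : p * column 1 j = column 1 j * q := by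
    conv_rhs => rw [← hcol j, mul_assoc, Unitary.star_mul_self_of_mem hq, mul_one]
  have hpq : p = q := by simpa [column_one_zero] using hcomm 0
  subst hpq
  have h1 := QuaternionAlgebra.ext_iff.1 (hcomm 1)
  have h2 := QuaternionAlgebra.ext_iff.1 (hcomm 2)
  simp at h1 h2
  have hI : p.imI = 0 := by linarith
  have hJ : p.imJ = 0 := by linarith
  have hK : p.imK = 0 := by linarith
  have hre : p.re ^ 2 = 1 := by
    simpa [normSq_def', hI, hJ, hK] using normSq_eq_one_of_mem_unitary hp
  rcases sq_eq_one_iff.1 hre with h | h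
  · have hp1 : p = 1 := by ext <;> simp [hI, hJ, hK, h]
    exact Or.inl (Prod.ext (Subtype.ext hp1) (Subtype.ext hp1))
  · have hp1 : p = -1 := by ext <;> simp [hI, hJ, hK, h]
    exact Or.inr (Prod.ext (Subtype.ext hp1) (Subtype.ext hp1))

instance : CompactSpace (unitary ℍ[ℝ]) := by
  have : ProperSpace ℍ[ℝ] := FiniteDimensional.proper_real _
  have h : (unitary ℍ[ℝ] : Set ℍ[ℝ]) = Metric.sphere 0 1 := by
    ext p
    rw [mem_sphere_zero_iff_norm, ← sq_eq_sq₀ (norm_nonneg p) zero_le_one, one_pow, sq,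
      ← normSq_eq_norm_mul_self]
    exact ⟨normSq_eq_one_of_mem_unitary, mem_unitary_of_normSq_eq_one⟩
  exact isCompact_iff_compactSpace.1 (h ▸ isCompact_sphere 0 1)

lemma isCoveringMap_spinHom : IsCoveringMap spinHom :=
  (Topology.IsQuotientMap.isQuotientCoveringMap_of_isDiscrete_ker_monoidHom
    (continuous_spinHom.isClosedMap.isQuotientMap continuous_spinHom spinHom_surjective)
    finite_ker_spinHom.isDiscrete).isCoveringMap

/-- The path `t ↦ exp (π i t)` in the unit quaternions. -/
noncomputable def halfTurn (t : ℝ) : unitary ℍ[ℝ] :=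
  ⟨(cos (π * t) : ℝ) + sin (π * t) • column 1 1,
    mem_unitary_of_normSq_eq_one (by simp [normSq_def'])⟩

lemma continuous_halfTurn : Continuous halfTurn := by
  refine Continuous.subtype_mk (Continuous.add (continuous_coe.comp ?_) ?_) _ <;> fun_prop

lemma coe_spinHom_halfTurn (t : ℝ) :
    (spinHom (halfTurn t, halfTurn t) : Matrix (Fin 4) (Fin 4) ℝ) = rotLoopMatrix t := by
  have h2 : 2 * π * t = 2 * (π * t) := by ring
  have h := sin_sq_add_cos_sq (π * t)
  ext i j
  fin_cases i <;> fin_cases j <;>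
    simp [coe_spinHom, halfTurn, leftMatrix, rightMatrix, rotLoopMatrix, Matrix.mul_apply,
      Fin.sum_univ_four, h2, sin_two_mul, cos_two_mul] <;> linarith

/-- The rotation loop in `SO(4)`. -/
noncomputable def rotLoop : Path (1 : SO4) (1 : SO4) where
  toFun t := spinHom (halfTurn t, halfTurn t)
  continuous_toFun := by
    have := continuous_spinHom
    have := continuous_halfTurn
    fun_prop
  source' := by
    ext1
    rw [coe_spinHom_halfTurn]
    ext i j
    fin_cases i <;> fin_cases j <;> simp [rotLoopMatrix]
  target' := by
    ext1
    rw [coe_spinHom_halfTurn]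
    ext i j
    fin_cases i <;> fin_cases j <;> simp [rotLoopMatrix]

lemma not_homotopic_rotLoop_refl : ¬ rotLoop.Homotopic (Path.refl 1) := by
  intro h
  have h₀ : rotLoop.toContinuousMap 0 = spinHom 1 := by simp
  have h₁ : (Path.refl (1 : SO4)).toContinuousMap 0 = spinHom 1 := by simp
  have key := isCoveringMap_spinHom.liftPath_apply_one_eq_of_homotopicRel h 1 h₀ h₁
  have hΓ : (fun t : unitInterval ↦ (halfTurn t, halfTurn t)) =
      isCoveringMap_spinHom.liftPath rotLoop.toContinuousMap 1 h₀ := by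
    refine (isCoveringMap_spinHom.eq_liftPath_iff h₀).2 ⟨?_, rfl, ?_⟩
    · have := continuous_halfTurn
      fun_prop
    · ext <;> simp [halfTurn]
  have hc : (fun _ : unitInterval ↦ 1) =
      isCoveringMap_spinHom.liftPath (Path.refl (1 : SO4)).toContinuousMap 1 h₁ :=
    (isCoveringMap_spinHom.eq_liftPath_iff h₁).2 ⟨continuous_const, by ext1; simp, rfl⟩
  rw [← congrFun hΓ, ← congrFun hc] at key
  have := congrArg (fun g : unitary ℍ[ℝ] × unitary ℍ[ℝ] ↦ (g.1 : ℍ[ℝ]).re) key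
  norm_num [halfTurn] at this

end QuaternionRotation

theorem rotation_loop_in_SO4_not_nullhomotopic :
    -- there is a loop `γ` in `SO(4)` based at the identity matrix given by the family of
    -- block-diagonal rotation matrices ...
    ∃ γ : Path (1 : SO4) (1 : SO4),
      (∀ t : unitInterval, (γ t : Matrix (Fin 4) (Fin 4) ℝ) = rotLoopMatrix t) ∧
      -- ... and it is not path-homotopic (rel endpoints) to the constant loop at the
      -- identity; moreover this holds for *any* loop with these values
      ¬ γ.Homotopic (Path.refl (1 : SO4)) ∧
      ∀ γ' : Path (1 : SO4) (1 : SO4),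
        (∀ t : unitInterval, (γ' t : Matrix (Fin 4) (Fin 4) ℝ) = rotLoopMatrix t) →
        ¬ γ'.Homotopic (Path.refl (1 : SO4)) := by
  have eq_rotLoop (γ : Path (1 : SO4) (1 : SO4))
      (hγ : ∀ t : unitInterval, (γ t : Matrix (Fin 4) (Fin 4) ℝ) = rotLoopMatrix t) :
      γ = QuaternionRotation.rotLoop := by
    ext1
    funext t
    exact Subtype.ext ((hγ t).trans (QuaternionRotation.coe_spinHom_halfTurn t).symm)
  refine ⟨QuaternionRotation.rotLoop, fun t ↦ QuaternionRotation.coe_spinHom_halfTurn t,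
    QuaternionRotation.not_homotopic_rotLoop_refl, fun γ hγ ↦ ?_⟩
  rw [eq_rotLoop γ hγ]
  exact QuaternionRotation.not_homotopic_rotLoop_refl
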